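/- Let α > 0 and d ≥ 1. There is a constant c(α,d) > 0 with the following property: if Γ is a finite simple graph with N vertices, maximum degree at most d, which is an α-expander, regarded as a 1-dimensional simplicial complex, and if I is a topological embedding of |Γ| into ℝ³ with combinatorial thickness at least 1, then the Lebesgue measure of the open 1-neighborhood of the image I(|Γ|) is at least c(α,d)·N^{3/2}. -/

import Mathlib

open scoped Classical
open Metric Set Function MeasureTheory

/-- An embedding `I` of the polyhedron of a geometric simplicial complex `X` has
combinatorial thickness at least `T` if the images of the convex hulls of any two
disjoint faces are at Euclidean distance at least `T` from each other. -/
def HasCombThickness {E F : Type*} [NormedAddCommGroup E] [NormedSpace ℝ E]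
    [NormedAddCommGroup F] [NormedSpace ℝ F]
    (X : Geometry.SimplicialComplex ℝ E) (I : X.space → F) (T : ℝ) : Prop :=
  ∀ s ∈ X.faces, ∀ t ∈ X.faces, Disjoint s t →
    ∀ x y : X.space, (x : E) ∈ convexHull ℝ (s : Set E) →
      (y : E) ∈ convexHull ℝ (t : Set E) → T ≤ dist (I x) (I y)

/-- A geometric simplicial complex `K` (together with a vertex map `f`) is a realization
of the simple graph `G`, regarded as a 1-dimensional simplicial complex. -/
def IsGraphRealization {V E : Type*} [NormedAddCommGroup E] [NormedSpace ℝ E]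
    (G : SimpleGraph V) (K : Geometry.SimplicialComplex ℝ E) (f : V → E) : Prop :=
  Function.Injective f ∧
    K.faces = {s : Finset E | (∃ v : V, s = {f v}) ∨ ∃ u v : V, G.Adj u v ∧ s = {f u, f v}}

/-- `G` is an `α`-expander. -/
def IsExpander {V : Type*} [Fintype V] [DecidableEq V] (G : SimpleGraph V)
    [DecidableRel G.Adj] (α : ℝ) : Prop :=
  ∀ A : Finset V, (A.card : ℝ) ≤ (Fintype.card V : ℝ) / 2 →
    α * (A.card : ℝ) ≤
      ((G.edgeFinset.filter fun e => ∃ u v : V, e = s(u, v) ∧ u ∈ A ∧ v ∉ A).card : ℝ)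

abbrev E3 := EuclideanSpace ℝ (Fin 3)

lemma vol_ball3 (x : E3) {r : ℝ} (hr : 0 ≤ r) :
    volume (ball x r) = ENNReal.ofReal (r ^ 3) * volume (ball (0 : E3) 1) := by
  have := Measure.addHaar_ball (volume : Measure E3) x hr
  simpa using this

/-- packing: a finite family of 1-separated half balls -/
lemma packing {ι : Type*} (M : Finset ι) (p : ι → E3) 
    (hsep : ∀ i ∈ M, ∀ j ∈ M, i ≠ j → 1 ≤ dist (p i) (p j)) (W : Set E3)
    (hW : ∀ i ∈ M, ball (p i) (1/2) ⊆ W) :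
    (M.card : ENNReal) * (ENNReal.ofReal (1/8) * volume (ball (0 : E3) 1)) ≤ volume W := by
  have h1 : volume (⋃ i ∈ M, ball (p i) (1/2)) = ∑ i ∈ M, volume (ball (p i) (1/2)) := by
    apply measure_biUnion_finset
    · intro i hi j hj hij
      apply ball_disjoint_ball
      have := hsep i hi j hj hij
      linarith
    · intro i _; exact measurableSet_ball
  have h2 : ∀ i ∈ M, volume (ball (p i) (1/2)) =
      ENNReal.ofReal (1/8) * volume (ball (0 : E3) 1) := by
    intro i _
    rw [vol_ball3 _ (by norm_num)]
    norm_num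
  rw [Finset.sum_congr rfl h2, Finset.sum_const, nsmul_eq_mul] at h1
  rw [← h1]
  exact measure_mono (iUnion₂_subset hW)

lemma v_pos : 0 < volume (ball (0 : E3) 1) := measure_ball_pos _ _ one_pos
lemma v_fin : volume (ball (0 : E3) 1) ≠ ⊤ := measure_ball_lt_top.ne

lemma exists_cover : ∃ F : Finset E3, ∀ (x : E3) (s : ℝ), 0 < s → ∀ y ∈ ball x (4 * s),
    ∃ z ∈ F, dist y (x + s • z) < s := by
  obtain ⟨t, -, ht, h⟩ := (isCompact_closedBall (0 : E3) 4).finite_cover_balls one_pos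
  refine ⟨ht.toFinset, fun x s hs y hy => ?_⟩
  have h3 : s⁻¹ • (y - x) ∈ closedBall (0 : E3) 4 := by
    rw [mem_closedBall_zero_iff, norm_smul, norm_inv, Real.norm_of_nonneg hs.le,
      inv_mul_le_iff₀ hs, ← dist_eq_norm]
    rw [mem_ball] at hy; linarith
  obtain ⟨z, hz, hd⟩ := mem_iUnion₂.1 (h h3)
  refine ⟨z, by simpa using hz, ?_⟩
  rw [mem_ball, dist_eq_norm] at hd
  have : y - (x + s • z) = s • (s⁻¹ • (y - x) - z) := by
    rw [smul_sub, smul_smul, mul_inv_cancel₀ hs.ne', one_smul]; abel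
  rw [dist_eq_norm, this, norm_smul, Real.norm_of_nonneg hs.le]
  nlinarith

/-- Matching among a finset of edges. -/
lemma exists_matching {V : Type} [Fintype V] [DecidableEq V] (G : SimpleGraph V)
    [DecidableRel G.Adj] (d : ℕ) (hdeg : ∀ v, G.degree v ≤ d) (C : Finset (Sym2 V))
    (hC : C ⊆ G.edgeFinset) :
    ∃ M ⊆ C, (∀ e ∈ M, ∀ e' ∈ M, e ≠ e' → ∀ v, v ∈ e → v ∉ e') ∧ C.card ≤ 2 * d * M.card := by
  let S := C.powerset.filter
    (fun M => ∀ e ∈ M, ∀ e' ∈ M, e ≠ e' → ∀ v, v ∈ e → v ∉ e')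
  have hS : S.Nonempty := ⟨∅, by simp [S]⟩
  obtain ⟨M, hM, hmax⟩ := S.exists_max_image Finset.card hS
  simp only [S, Finset.mem_filter, Finset.mem_powerset] at hM hmax
  refine ⟨M, hM.1, hM.2, ?_⟩
  have hcov : C ⊆ M.biUnion (fun e => e.toFinset.biUnion (fun v => G.incidenceFinset v)) := by
    intro e he
    by_contra hne
    simp only [Finset.mem_biUnion, Sym2.mem_toFinset, SimpleGraph.mem_incidenceFinset,
      not_exists, not_and] at hne
    have hed : e ∈ G.edgeSet := by simpa using hC he
    have hno : ∀ e' ∈ M, ∀ v ∈ e', v ∉ e := fun e' he' v hv hve =>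
      hne e' he' v hv ⟨hed, hve⟩
    have heM : e ∉ M := by
      intro h
      induction e with | h a b => exact hno _ h a (by simp) (by simp)
    have := hmax (insert e M) ⟨Finset.insert_subset he hM.1, ?_⟩
    · rw [Finset.card_insert_of_notMem heM] at this; omega
    · intro a ha b hb hab v hva hvb
      rcases Finset.mem_insert.1 ha with rfl | ha' <;> rcases Finset.mem_insert.1 hb with rfl | hb'
      · exact hab rfl
      · exact hno _ hb' v hvb hva
      · exact hno _ ha' v hva hvb
      · exact hM.2 a ha' b hb' hab v hva hvb
  calc C.card ≤ _ := Finset.card_le_card hcov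
    _ ≤ M.card * (2 * d) := by
      apply Finset.card_biUnion_le_card_mul
      intro e he
      have : e.toFinset.card ≤ 2 := by
        rw [Sym2.card_toFinset]; split_ifs <;> omega
      refine (Finset.card_biUnion_le_card_mul _ _ d ?_).trans (Nat.mul_le_mul_right d this)
      intro v _
      rw [SimpleGraph.card_incidenceFinset_eq_degree]; exact hdeg v
    _ = _ := by ring

lemma edge_cross {V E : Type} [NormedAddCommGroup E] [NormedSpace ℝ E]
    (G : SimpleGraph V) (K : Geometry.SimplicialComplex ℝ E) (f : V → E)
    (hK : IsGraphRealization G K f) (I : K.space → E3) (hI : Continuous I)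
    (hf : ∀ v, f v ∈ K.space) (u v : V) (huv : G.Adj u v) (x : E3) (t : ℝ)
    (hu : dist (I ⟨f u, hf u⟩) x < t) (hv : t ≤ dist (I ⟨f v, hf v⟩) x) :
    ∃ y : K.space, (y : E) ∈ convexHull ℝ (({f u, f v} : Finset E) : Set E) ∧
      dist (I y) x = t := by
  have hface : ({f u, f v} : Finset E) ∈ K.faces := by
    rw [hK.2]; exact Or.inr ⟨u, v, huv, rfl⟩
  have hsub : convexHull ℝ (({f u, f v} : Finset E) : Set E) ⊆ K.space :=
    K.convexHull_subset_space hface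
  have hpre : IsPreconnected
      ((Subtype.val : K.space → E) ⁻¹' convexHull ℝ (({f u, f v} : Finset E) : Set E)) := by
    rw [← Topology.IsInducing.subtypeVal.isPreconnected_image, Subtype.image_preimage_coe,
      inter_eq_right.2 hsub]
    exact (convex_convexHull ℝ _).isPreconnected
  have := hpre.intermediate_value (a := ⟨f u, hf u⟩) (b := ⟨f v, hf v⟩)
    (subset_convexHull ℝ _ (by simp)) (subset_convexHull ℝ _ (by simp))
    (f := fun y => dist (I y) x) (by fun_prop)
  obtain ⟨y, hy, h⟩ := this ⟨hu.le, hv⟩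
  exact ⟨y, hy, h⟩

lemma step {V E : Type} [Fintype V] [DecidableEq V] [NormedAddCommGroup E] [NormedSpace ℝ E]
    (G : SimpleGraph V) [DecidableRel G.Adj] (α : ℝ) (d : ℕ) (hdeg : ∀ v, G.degree v ≤ d)
    (hexp : IsExpander G α) (K : Geometry.SimplicialComplex ℝ E) (f : V → E)
    (hK : IsGraphRealization G K f) (I : K.space → E3) (hI : Continuous I)
    (hT : HasCombThickness K I 1)
    (hf : ∀ v, f v ∈ K.space) (x : E3) (t : ℝ)
    (hA : ((Finset.univ.filter fun v => dist (I ⟨f v, hf v⟩) x < t).card : ℝ) ≤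
      (Fintype.card V : ℝ) / 2) :
    ∃ n : ℕ, α * ((Finset.univ.filter fun v => dist (I ⟨f v, hf v⟩) x < t).card : ℝ) ≤
        2 * d * n ∧
      (n : ENNReal) * (ENNReal.ofReal (1/8) * volume (ball (0 : E3) 1)) ≤
        volume (Metric.thickening 1 (Set.range I) ∩ {y | |dist y x - t| < 1/2}) := by
  have h1 := hexp _ hA
  set A := Finset.univ.filter fun v => dist (I ⟨f v, hf v⟩) x < t with hAdef
  obtain ⟨M, hMC, hM, hcard⟩ := exists_matching G d hdeg
    (G.edgeFinset.filter fun e => ∃ u v : V, e = s(u, v) ∧ u ∈ A ∧ v ∉ A)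
    (Finset.filter_subset _ _)
  refine ⟨M.card, h1.trans (by exact_mod_cast hcard), ?_⟩
  have hp : ∀ e ∈ M, ∃ y : K.space, ∃ u v : V, e = s(u, v) ∧ G.Adj u v ∧
      (y : E) ∈ convexHull ℝ (({f u, f v} : Finset E) : Set E) ∧ dist (I y) x = t := by
    intro e he
    obtain ⟨hed, u, v, rfl, hu, hv⟩ := Finset.mem_filter.1 (hMC he)
    have hadj : G.Adj u v := by simpa using hed
    simp only [hAdef, Finset.mem_filter, Finset.mem_univ, true_and, not_lt] at hu hv
    obtain ⟨y, hy, h⟩ := edge_cross G K f hK I hI hf u v hadj x t hu hv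
    exact ⟨y, u, v, rfl, hadj, hy, h⟩
  by_cases hne : M.Nonempty
  · obtain ⟨e0, he0⟩ := hne
    obtain ⟨y0, u0, -⟩ := hp e0 he0
    have : Nonempty V := ⟨u0⟩
    have : Nonempty K.space := ⟨y0⟩
    choose! p u v hpe hadj hpm hpt using hp
    have hm1 : ∀ e ∈ M, u e ∈ e := fun e he =>
      Eq.subst (motive := fun q => u e ∈ q) (hpe e he).symm (Sym2.mem_mk_left _ _)
    have hm2 : ∀ e ∈ M, v e ∈ e := fun e he =>
      Eq.subst (motive := fun q => v e ∈ q) (hpe e he).symm (Sym2.mem_mk_right _ _)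
    refine packing M (fun e => I (p e)) ?_ _ ?_
    · intro e he e' he' hee'
      refine hT {f (u e), f (v e)} ?_ {f (u e'), f (v e')} ?_ ?_ (p e) (p e') (hpm e he)
        (hpm e' he')
      · rw [hK.2]; exact Or.inr ⟨_, _, hadj e he, rfl⟩
      · rw [hK.2]; exact Or.inr ⟨_, _, hadj e' he', rfl⟩
      · have h3 : ∀ w, w ∈ e → w ∉ e' := hM e he e' he' hee'
        have hu := h3 (u e) (hm1 e he)
        have hv := h3 (v e) (hm2 e he)
        rw [hpe e' he', Sym2.mem_iff, not_or] at hu hv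
        simp only [Finset.disjoint_left, Finset.mem_insert, Finset.mem_singleton]
        rintro a (rfl | rfl) (h | h)
        · exact hu.1 (hK.1 h)
        · exact hu.2 (hK.1 h)
        · exact hv.1 (hK.1 h)
        · exact hv.2 (hK.1 h)
    · intro e he y hy
      rw [mem_ball] at hy
      refine ⟨mem_thickening_iff.2 ⟨_, mem_range_self (p e), by linarith⟩, ?_⟩
      have := abs_dist_sub_le y (I (p e)) x
      rw [hpt e he] at this
      exact this.trans_lt hy
  · rw [Finset.not_nonempty_iff_eq_empty.1 hne]; simp

lemma shell_upper (x : E3) (t : ℝ) (ht : 1/2 ≤ t) (n : ℕ) (W : Set E3)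
    (h : (n : ENNReal) * (ENNReal.ofReal (1/8) * volume (ball (0 : E3) 1)) ≤
      volume (W ∩ {y | |dist y x - t| < 1/2})) : (n : ℝ) ≤ 8 * (3 * t ^ 2 + 1/4) := by
  have h1 : volume ((W ∩ {y | |dist y x - t| < 1/2}) ∪ ball x (t - 1/2)) =
      volume (W ∩ {y | |dist y x - t| < 1/2}) + volume (ball x (t - 1/2)) := by
    apply measure_union _ measurableSet_ball
    rw [Set.disjoint_left]
    rintro y ⟨-, hy⟩ hy'
    rw [mem_ofPred_eq, abs_lt] at hy
    rw [mem_ball] at hy'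
    linarith
  have h2 : volume ((W ∩ {y | |dist y x - t| < 1/2}) ∪ ball x (t - 1/2)) ≤
      volume (ball x (t + 1/2)) := by
    apply measure_mono
    rintro y (⟨-, hy⟩ | hy)
    · rw [mem_ofPred_eq, abs_lt] at hy
      rw [mem_ball]; linarith
    · exact ball_subset_ball (by linarith) hy
  have h3 := (add_le_add_left h (volume (ball x (t - 1/2)))).trans (h1.symm.le.trans h2)
  rw [vol_ball3 x (r := t - 1/2) (by linarith), vol_ball3 x (r := t + 1/2) (by linarith), ← mul_assoc, ← add_mul,
    ENNReal.mul_le_mul_iff_left v_pos.ne' v_fin, ← ENNReal.ofReal_natCast,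
    ← ENNReal.ofReal_mul (by positivity), ← ENNReal.ofReal_add (by positivity)
      (pow_nonneg (by linarith) 3), ENNReal.ofReal_le_ofReal_iff (pow_nonneg (by linarith) 3)] at h3
  nlinarith

lemma ball_upper {V : Type} (M : Finset V) (g : V → E3) (x : E3)
    (hsep : ∀ i ∈ M, ∀ j ∈ M, i ≠ j → 1 ≤ dist (g i) (g j))
    (hx : ∀ i ∈ M, dist (g i) x < 1) : M.card ≤ 27 := by
  have h := packing M g hsep (ball x (3/2)) (by
    intro i hi
    apply ball_subset_ball'
    have := hx i hi
    linarith)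
  rw [vol_ball3 x (by norm_num), ← mul_assoc,
    ENNReal.mul_le_mul_iff_left v_pos.ne' v_fin, ← ENNReal.ofReal_natCast,
    ← ENNReal.ofReal_mul (by positivity), ENNReal.ofReal_le_ofReal_iff (by positivity)] at h
  have : (M.card : ℝ) ≤ 27 := by linarith
  exact_mod_cast this

lemma shells_sum (x : E3) (t : ℝ) (s : ℕ) (W : Set E3) (hW : IsOpen W) (b : ENNReal)
    (h : ∀ k < s, b ≤ volume (W ∩ {y | |dist y x - (t + k)| < 1/2})) :
    (s : ENNReal) * b ≤ volume W := by
  have h1 : volume (⋃ k ∈ Finset.range s, (W ∩ {y | |dist y x - (t + (k : ℕ))| < 1/2})) =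
      ∑ k ∈ Finset.range s, volume (W ∩ {y | |dist y x - (t + (k : ℕ))| < 1/2}) := by
    apply measure_biUnion_finset
    · intro i _ j _ hij
      rw [Function.onFun, Set.disjoint_left]
      rintro y ⟨-, hy⟩ ⟨-, hy'⟩
      rw [mem_ofPred_eq, abs_lt] at hy hy'
      apply hij
      have a1 : (i : ℝ) < j + 1 := by linarith
      have a2 : (j : ℝ) < i + 1 := by linarith
      have a1 : i < j + 1 := by exact_mod_cast a1
      have a2 : j < i + 1 := by exact_mod_cast a2
      omega
    · intro k _
      refine (hW.inter (isOpen_lt ?_ continuous_const)).measurableSet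
      fun_prop
  calc (s : ENNReal) * b = ∑ k ∈ Finset.range s, b := by simp
    _ ≤ _ := Finset.sum_le_sum fun k hk => h k (Finset.mem_range.1 hk)
    _ = _ := h1.symm
    _ ≤ _ := measure_mono (iUnion₂_subset fun _ _ => inter_subset_left)

/-- For all `α > 0` and `d ≥ 1` there is `c(α, d) > 0` such that
whenever an `α`-expander graph with `N` vertices and maximum degree at most `d`
is topologically embedded in `ℝ³` with combinatorial thickness at least `1`, the
Lebesgue measure of the open `1`-neighborhood of the image is at least
`c(α, d) * N^(3/2)`. -/
theorem statement3 (α : ℝ) (hα : 0 < α) (d : ℕ) (hd : 1 ≤ d) :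
    ∃ c : ℝ, 0 < c ∧
      ∀ (V : Type) [Fintype V] [DecidableEq V] (G : SimpleGraph V) [DecidableRel G.Adj],
        (∀ v : V, G.degree v ≤ d) → IsExpander G α →
        ∀ (E : Type) [NormedAddCommGroup E] [NormedSpace ℝ E]
          (K : Geometry.SimplicialComplex ℝ E) (f : V → E),
          IsGraphRealization G K f →
          ∀ I : K.space → EuclideanSpace ℝ (Fin 3),
            Continuous I → Function.Injective I →
            HasCombThickness K I 1 →
            ENNReal.ofReal (c * (Fintype.card V : ℝ) ^ ((3 : ℝ) / 2)) ≤
              volume (Metric.thickening 1 (Set.range I)) := by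
  obtain ⟨F, hF⟩ := exists_cover
  obtain ⟨K₀, hFK, hKpos⟩ : ∃ K₀ : ℕ, F.card ≤ K₀ ∧ 0 < K₀ := ⟨F.card + 1, by omega, by omega⟩
  have hd0 : (0 : ℝ) < d := by exact_mod_cast hd
  have hK0 : (0 : ℝ) < K₀ := by exact_mod_cast hKpos
  obtain ⟨β, hβ0, hβ⟩ : ∃ β : ℝ, 0 < β ∧ β * (4 * K₀ * d) = α :=
    ⟨α / (4 * K₀ * d), by positivity, div_mul_cancel₀ _ (by positivity)⟩
  obtain ⟨w, hw0, hvw⟩ : ∃ w : ℝ, 0 < w ∧ volume (ball (0 : E3) 1) = ENNReal.ofReal w :=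
    ⟨_, ENNReal.toReal_pos v_pos.ne' v_fin, (ENNReal.ofReal_toReal v_fin).symm⟩
  refine ⟨min (w / (54 * K₀ : ℝ) ^ ((3 : ℝ) / 2)) (β / 8 * Real.sqrt (β / 128) * w),
    lt_min (by positivity) (by positivity), ?_⟩
  intro V _ _ G _ hdeg hexp E _ _ K f hK I hI hinj hT
  set N := Fintype.card V
  have hf : ∀ v, f v ∈ K.space := fun v =>
    K.convexHull_subset_space (s := {f v}) (by rw [hK.2]; exact Or.inl ⟨v, rfl⟩) (by simp)
  set g : V → E3 := fun v => I ⟨f v, hf v⟩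
  have hsep : ∀ i j, i ≠ j → 1 ≤ dist (g i) (g j) := by
    intro i j hij
    refine hT {f i} ?_ {f j} ?_ ?_ _ _ (by simp) (by simp)
    · rw [hK.2]; exact Or.inl ⟨i, rfl⟩
    · rw [hK.2]; exact Or.inl ⟨j, rfl⟩
    · simpa using fun h => hij (hK.1 h)
  rcases Nat.eq_zero_or_pos N with hN0 | hNpos
  · rw [hN0]; simp [Real.zero_rpow]
  have hNr : (0 : ℝ) < N := by exact_mod_cast hNpos
  have hV : Nonempty V := Fintype.card_pos_iff.1 hNpos
  let P : ℕ → Prop := fun j => ∃ x : E3,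
    N ≤ 2 * K₀ * (Finset.univ.filter fun v => dist (g v) x < 2 ^ j).card
  have hP : ∃ j, P j := by
    obtain ⟨R, hR⟩ := Finite.bddAbove_range (fun v => dist (g v) 0)
    obtain ⟨j, hj⟩ := pow_unbounded_of_one_lt R (one_lt_two (α := ℝ))
    refine ⟨j, 0, ?_⟩
    rw [Finset.filter_true_of_mem (fun v _ => (hR ⟨v, rfl⟩).trans_lt hj), Finset.card_univ]
    nlinarith
  have hj0 := Nat.find_spec hP
  have hmin : ∀ m < Nat.find hP, ¬ P m := fun m => Nat.find_min hP
  rcases hj : Nat.find hP with _ | j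
  · rw [hj] at hj0
    obtain ⟨x, hx⟩ := hj0
    have h27 := ball_upper (Finset.univ.filter fun v => dist (g v) x < 2 ^ 0) g x
      (fun i _ j _ => hsep i j) (fun i hi => by simpa using (Finset.mem_filter.1 hi).2)
    have hN54 : N ≤ 54 * K₀ := by nlinarith
    have hN54 : (N : ℝ) ≤ 54 * K₀ := by exact_mod_cast hN54
    obtain ⟨v0⟩ := hV
    calc _ ≤ ENNReal.ofReal w := by
          apply ENNReal.ofReal_le_ofReal
          calc _ ≤ w / (54 * K₀ : ℝ) ^ ((3 : ℝ) / 2) * (54 * K₀ : ℝ) ^ ((3 : ℝ) / 2) := by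
                gcongr
                exact min_le_left _ _
            _ = w := div_mul_cancel₀ _ (by positivity)
      _ = volume (ball (g v0) 1) := by rw [vol_ball3 _ zero_le_one, hvw]; simp
      _ ≤ _ := measure_mono (ball_subset_thickening (mem_range_self (⟨f v0, hf v0⟩ : K.space)) 1)
  · rw [hj] at hj0
    have hnot : ¬ P j := hmin j (by omega)
    obtain ⟨x, hx⟩ := hj0
    simp only [P, not_exists, not_le] at hnot
    set s : ℕ := 2 ^ j with hs
    have hs1 : 1 ≤ s := Nat.one_le_two_pow
    have hsr : (1 : ℝ) ≤ s := by exact_mod_cast hs1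
    have hsj : (2 : ℝ) ^ j = s := by rw [hs]; push_cast; rfl
    have h4 : (Finset.univ.filter fun v => dist (g v) x < 4 * s).card * (2 * K₀) ≤ K₀ * N := by
      have hsub : (Finset.univ.filter fun v => dist (g v) x < 4 * s) ⊆
          F.biUnion fun z => Finset.univ.filter fun v => dist (g v) (x + (s : ℝ) • z) < 2 ^ j := by
        intro v hv
        obtain ⟨z, hz, hd⟩ := hF x s (by linarith) (g v) (Finset.mem_filter.1 hv).2
        exact Finset.mem_biUnion.2 ⟨z, hz, by simpa [hsj] using hd⟩
      calc _ ≤ (∑ z ∈ F, (Finset.univ.filter fun v =>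
              dist (g v) (x + (s : ℝ) • z) < 2 ^ j).card) * (2 * K₀) :=
            Nat.mul_le_mul_right _ ((Finset.card_le_card hsub).trans Finset.card_biUnion_le)
        _ = ∑ z ∈ F, (2 * K₀ * (Finset.univ.filter fun v =>
              dist (g v) (x + (s : ℝ) • z) < 2 ^ j).card) := by
            rw [Finset.sum_mul]; exact Finset.sum_congr rfl fun _ _ => mul_comm _ _
        _ ≤ ∑ z ∈ F, N := Finset.sum_le_sum fun z _ => (hnot _).le
        _ = F.card * N := by simp
        _ ≤ K₀ * N := Nat.mul_le_mul_right _ hFK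
    have hstep : ∀ t : ℝ, 2 * s ≤ t → t ≤ 4 * s → ∃ n : ℕ, β * N ≤ n ∧
        (n : ENNReal) * (ENNReal.ofReal (1/8) * volume (ball (0 : E3) 1)) ≤
        volume (Metric.thickening 1 (Set.range I) ∩ {y | |dist y x - t| < 1/2}) := by
      intro t ht1 ht2
      have c1 : (Finset.univ.filter fun v => dist (g v) x < t).card ≤
          (Finset.univ.filter fun v => dist (g v) x < 4 * s).card :=
        Finset.card_le_card (Finset.monotone_filter_right _ fun v _ h => lt_of_lt_of_le h ht2)
      have c2 : (Finset.univ.filter fun v => dist (g v) x < 2 ^ (j + 1)).card ≤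
          (Finset.univ.filter fun v => dist (g v) x < t).card :=
        Finset.card_le_card (Finset.monotone_filter_right _ fun v _ h =>
          lt_of_lt_of_le h (by rw [pow_succ, hsj]; linarith))
      have c3 : 2 * (Finset.univ.filter fun v => dist (g v) x < t).card ≤ N := by
        have : K₀ * (2 * (Finset.univ.filter fun v => dist (g v) x < t).card) ≤ K₀ * N := by
          nlinarith
        exact Nat.le_of_mul_le_mul_left this hKpos
      have c4 : N ≤ 2 * K₀ * (Finset.univ.filter fun v => dist (g v) x < t).card :=
        hx.trans (Nat.mul_le_mul_left _ c2)
      have c3' : 2 * ((Finset.univ.filter fun v => dist (g v) x < t).card : ℝ) ≤ N := by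
        exact_mod_cast c3
      have c4' : (N : ℝ) ≤ 2 * K₀ * (Finset.univ.filter fun v => dist (g v) x < t).card := by
        exact_mod_cast c4
      obtain ⟨n, hn1, hn2⟩ := step G α d hdeg hexp K f hK I hI hT hf x t
        (by rw [le_div_iff₀ two_pos, mul_comm]; exact c3')
      refine ⟨n, ?_, hn2⟩
      refine le_of_mul_le_mul_right ?_ (show (0 : ℝ) < 4 * K₀ * d by positivity)
      rw [show β * N * (4 * K₀ * d) = α * N by rw [← hβ]; ring]
      calc α * N ≤ α * (2 * K₀ * (Finset.univ.filter fun v => dist (g v) x < t).card) := by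
            gcongr
        _ = 2 * K₀ * (α * (Finset.univ.filter fun v => dist (g v) x < t).card) := by ring
        _ ≤ 2 * K₀ * (2 * d * n) := by gcongr
        _ = _ := by ring
    have hs2 : β / 128 * N ≤ (s : ℝ) ^ 2 := by
      obtain ⟨n, hn1, hn2⟩ := hstep (2 * s) le_rfl (by linarith)
      have := shell_upper x (2 * s) (by linarith) n _ hn2
      nlinarith
    have hs3 : Real.sqrt (β / 128) * Real.sqrt N ≤ s := by
      rw [← Real.sqrt_mul (by positivity)]
      exact Real.sqrt_le_iff.2 ⟨by positivity, hs2⟩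
    have hfin := shells_sum x (2 * s) s (Metric.thickening 1 (Set.range I)) isOpen_thickening
      (ENNReal.ofReal (β * N * (1/8 * w))) (by
        intro k hk
        have hk' : (k : ℝ) ≤ s := by exact_mod_cast hk.le
        obtain ⟨n, hn1, hn2⟩ := hstep (2 * s + k) (by linarith [k.cast_nonneg (α := ℝ)])
          (by linarith)
        refine le_trans ?_ hn2
        rw [hvw, ← ENNReal.ofReal_natCast, ← ENNReal.ofReal_mul (by positivity),
          ← ENNReal.ofReal_mul (by positivity)]
        gcongr)
    refine le_trans ?_ hfin
    rw [← ENNReal.ofReal_natCast, ← ENNReal.ofReal_mul (by positivity)]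
    apply ENNReal.ofReal_le_ofReal
    have hpow : (N : ℝ) ^ ((3 : ℝ) / 2) = N * Real.sqrt N := by
      rw [show (3 : ℝ) / 2 = 1 + 1 / 2 by norm_num, Real.rpow_add hNr, Real.rpow_one,
        Real.sqrt_eq_rpow]
    rw [hpow]
    calc _ ≤ (β / 8 * Real.sqrt (β / 128) * w) * (N * Real.sqrt N) := by
          gcongr; exact min_le_right _ _
      _ = (Real.sqrt (β / 128) * Real.sqrt N) * (β * N * (1/8 * w)) := by ring
      _ ≤ _ := by gcongr
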